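/- arXiv:1109.0106 — 3 statements merged into one kernel-verified Lean document; each statement's English description precedes it below -/
import Mathlib

section
/- Let C be a small category with κ-limits, coequalizers of reflexive pairs and filtered κ'-colimits which is Barr-exact (E1') and in which finite limits commute with filtered κ'-colimits (E2'). Then the smallest Grothendieck topology τ on C for which the sieve generated by any single regular epimorphism is covering and the sieve generated by the cocone injections of any filtered κ'-colimit cocone is covering is subcanonical, i.e. every representable presheaf is a τ-sheaf. -/
open CategoryTheory CategoryTheory.Limits Opposite

universe w v u

namespace AlgExact

/-- The cardinality of the set of morphisms of a category. -/
noncomputable def homCard (J : Type u) [Category.{v} J] : Cardinal.{max u v} :=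
  Cardinal.mk (Σ (X : J) (Y : J), X ⟶ Y)

/-- `κ' = (Σ_{γ<κ} 2^γ)⁺`.  (For infinite regular `κ` this sum coincides with the
supremum of the cardinals `2^γ` for `γ < κ`, which we use so as to remain in the same
universe of cardinals.) -/
noncomputable def kappaPrime (κ : Cardinal.{v}) : Cardinal.{v} :=
  Order.succ (sSup {c : Cardinal.{v} | ∃ γ < κ, c = 2 ^ γ})

/-- `f` is a regular epimorphism. -/
def IsRegularEpi {C : Type u} [Category.{v} C] {X Y : C} (f : X ⟶ Y) : Prop :=
  Nonempty (RegularEpi f)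

/-- `(a, b) : R ⇉ X` is an internal equivalence relation. -/
structure IsEquivRelation {C : Type u} [Category.{v} C] {R X : C} (a b : R ⟶ X) : Prop where
  jointMono : ∀ {Z : C} (f g : Z ⟶ R), f ≫ a = g ≫ a → f ≫ b = g ≫ b → f = g
  refl : ∃ r : X ⟶ R, r ≫ a = 𝟙 X ∧ r ≫ b = 𝟙 X
  symm : ∃ s : R ⟶ R, s ≫ a = b ∧ s ≫ b = a
  trans : ∀ {P : C} (p₁ p₂ : P ⟶ R), IsPullback p₁ p₂ b a →
    ∃ t : P ⟶ R, t ≫ a = p₁ ≫ a ∧ t ≫ b = p₂ ≫ b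

/-- Regular epimorphisms are stable under pullback. -/
def RegEpisStableUnderPullback (C : Type u) [Category.{v} C] : Prop :=
  ∀ {P X Y Z : C} (fst : P ⟶ X) (snd : P ⟶ Y) (f : X ⟶ Z) (g : Y ⟶ Z),
    IsPullback fst snd f g → IsRegularEpi g → IsRegularEpi fst

/-- (E1): `C` is Barr-exact: regular epimorphisms are stable under pullback and every
internal equivalence relation is effective (a kernel pair of some morphism). -/
def BarrExact (C : Type u) [Category.{v} C] : Prop :=
  RegEpisStableUnderPullback C ∧
  (∀ {R X : C} (a b : R ⟶ X), IsEquivRelation a b →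
      ∃ (Y : C) (f : X ⟶ Y), IsKernelPair f a b)

/-- (E2'): finite limits commute with filtered κ'-colimits. -/
def FinLimsCommuteFilteredColimsBdd (C : Type u) [Category.{v} C] (κ' : Cardinal.{v}) : Prop :=
  ∀ (K : Type v) [SmallCategory K] [IsFiltered K] [HasColimitsOfShape K C],
    homCard K < κ' → Nonempty (PreservesFiniteLimits (colim (J := K) (C := C)))

/-- The smallest Grothendieck topology on `C` in which the sieve generated by any single
regular epimorphism is covering, and the sieve generated by the cocone injections of any
filtered κ'-colimit cocone is covering. -/
def genTopology (C : Type u) [SmallCategory C] (κ : Cardinal.{u}) : GrothendieckTopology C :=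
  sInf {J : GrothendieckTopology C |
    (∀ {A X : C} (e : A ⟶ X), IsRegularEpi e →
        Sieve.generate (Presieve.singleton e) ∈ J X) ∧
    (∀ (K : Type u) [SmallCategory K] [IsFiltered K], homCard K < kappaPrime κ →
      ∀ (D : K ⥤ C) (c : Cocone D), Nonempty (IsColimit c) →
        Sieve.generate (Presieve.ofArrows (fun k => D.obj k) (fun k => c.ι.app k)) ∈ J c.pt)}

/-- A category with limits of all shapes with fewer than `κ` morphisms, `κ` infinite, has
pullbacks. -/
theorem hasPullbacks_of_hasLimitsOfShape {C : Type u} [SmallCategory C] {κ : Cardinal.{u}}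
    (hκ : Cardinal.aleph0 ≤ κ)
    (hlim : ∀ (I : Type u) [SmallCategory I], homCard I < κ → HasLimitsOfShape I C) :
    HasPullbacks C := by
  let I : Type u := ULiftHom.{u} (ULift.{u} WalkingCospan)
  have hI : homCard I < κ := (Cardinal.mk_lt_aleph0 (α := Σ (X : I) (Y : I), X ⟶ Y)).trans_le hκ
  have := hlim I hI
  exact hasLimitsOfShape_of_equivalence (ULiftHomULiftCategory.equiv.{u, u} WalkingCospan).symm

/-- If `colim : (K ⥤ C) ⥤ C` preserves finite limits and `K` is connected, then colimit cocones
of shape `K` are stable under pullback. -/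
theorem nonempty_isColimit_of_isPullback {C : Type u} [Category.{v} C] {K : Type w}
    [Category.{w} K] [IsConnected K] [HasColimitsOfShape K C]
    [PreservesFiniteLimits (colim (J := K) (C := C))] {D P : K ⥤ C} {c : Cocone D}
    (hc : IsColimit c) {Y : C} {f : Y ⟶ c.pt} {fst : P ⟶ (Functor.const K).obj Y} {snd : P ⟶ D}
    (h : IsPullback fst snd ((Functor.const K).map f) c.ι) :
    Nonempty (IsColimit (Cocone.mk Y fst)) := by
  let φ (Z : C) : colim.obj ((Functor.const K).obj Z) ≅ Z :=
    (colimit.isColimit _).coconePointUniqueUpToIso (isColimitConstCocone K Z)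
  have hφ (Z : C) (k : K) : colimit.ι ((Functor.const K).obj Z) k ≫ (φ Z).hom = 𝟙 Z :=
    IsColimit.comp_coconePointUniqueUpToIso_hom _ (isColimitConstCocone K Z) k
  have key : ∀ {E : K ⥤ C} {Z : C} (ι : E ⟶ (Functor.const K).obj Z),
      (colimit.isColimit E).desc (Cocone.mk Z ι) = colim.map ι ≫ (φ Z).hom := by
    intro E Z ι
    refine (colimit.isColimit E).hom_ext fun k => ((colimit.isColimit E).fac _ k).trans ?_
    have h₁ : colimit.ι E k ≫ colim.map ι = ι.app k ≫ colimit.ι ((Functor.const K).obj Z) k :=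
      colimit.ι_map ι k
    change ι.app k = colimit.ι E k ≫ colim.map ι ≫ (φ Z).hom
    exact (((Category.assoc _ _ _).symm.trans (h₁ =≫ (φ Z).hom)).trans
      ((Category.assoc _ _ _).trans ((_ ≫= hφ Z k).trans (Category.comp_id _)))).symm
  have hcι : IsIso (colim.map c.ι) := by
    have hd : IsIso ((colimit.isColimit D).desc (Cocone.mk c.pt c.ι)) :=
      ((colimit.isColimit D).coconePointUniqueUpToIso hc).isIso_hom
    rw [key c.ι] at hd
    exact @IsIso.of_isIso_comp_right _ _ _ _ _ _ (φ c.pt).hom (φ c.pt).isIso_hom hd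
  have hfst : IsIso (colim.map fst) := (h.map colim).isIso_fst_of_isIso
  have : IsIso ((colimit.isColimit P).desc (Cocone.mk Y fst)) := by
    rw [key fst]
    exact @IsIso.comp_isIso _ _ _ _ _ _ _ hfst (φ Y).isIso_hom
  exact ⟨IsColimit.ofPointIso (colimit.isColimit P)⟩

/-- The sieve generated by a regular epimorphism is a sieve of descent for representables. -/
theorem IsRegularEpi.isSheafFor_generate {C : Type u} [Category.{v} C] {A X : C} {e : A ⟶ X}
    (he : IsRegularEpi e) (Z : C) :
    Presieve.IsSheafFor (yoneda.obj Z) (Sieve.generate (Presieve.singleton e)).arrows := by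
  have := he.some.effectiveEpi
  have h := (Sieve.effectiveEpimorphic_singleton e).mpr this
  exact (Sieve.forallYonedaIsSheaf_iff_colimit _).mpr h Z

/-- The sieve generated by the injections of a colimit cocone is a sieve of descent for
representables. -/
theorem isSheafFor_generate_of_isColimit {C : Type u} [Category.{v} C] {K : Type w}
    [Category.{w} K] {D : K ⥤ C} {c : Cocone D} (hc : IsColimit c) (Z : C) :
    Presieve.IsSheafFor (yoneda.obj Z)
      (Sieve.generate (Presieve.ofArrows D.obj (fun k => c.ι.app k))).arrows := by
  rw [← Presieve.isSheafFor_iff_generate, Presieve.isSheafFor_arrows_iff]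
  intro x hx
  let s : Cocone D :=
    { pt := Z
      ι :=
        { app := x
          naturality := fun i j g => by
            simpa using hx j i (D.obj i) (D.map g) (𝟙 _) (by simp) } }
  refine ⟨hc.desc s, fun k => hc.fac s k, fun t ht => ?_⟩
  exact hc.uniq s t ht

/-- The pullback of the sieve generated by a family of arrows is generated by the pullbacks of
these arrows. -/
theorem pullback_generate_ofArrows {C : Type u} [Category.{v} C] {ι : Type w} {X Y : C}
    {A B : ι → C} {a : ∀ i, A i ⟶ X} {f : Y ⟶ X} {b : ∀ i, B i ⟶ Y} {p : ∀ i, B i ⟶ A i}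
    (h : ∀ i, IsPullback (b i) (p i) f (a i)) :
    (Sieve.generate (Presieve.ofArrows A a)).pullback f =
      Sieve.generate (Presieve.ofArrows B b) := by
  ext W g
  constructor
  · rintro ⟨_, q, _, ⟨i⟩, hq⟩
    exact ⟨_, (h i).lift g q hq.symm, _, ⟨i⟩, (h i).lift_fst _ _ _⟩
  · rintro ⟨_, q, _, ⟨i⟩, rfl⟩
    exact ⟨_, q ≫ p i, _, ⟨i⟩, by simp [(h i).w]⟩

/-- The topology generated by regular epimorphisms and filtered colimit cocones is coarser than
the canonical topology. -/
theorem genTopology_le_canonicalTopology {C : Type u} [SmallCategory C] (κ : Cardinal.{u})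
    [HasPullbacks C]
    (hfilt : ∀ (K : Type u) [SmallCategory K] [IsFiltered K],
      homCard K < kappaPrime κ → HasColimitsOfShape K C)
    (hreg : RegEpisStableUnderPullback C)
    (hcomm : FinLimsCommuteFilteredColimsBdd C (kappaPrime κ)) :
    genTopology C κ ≤ Sheaf.canonicalTopology C := by
  refine sInf_le ⟨fun {A X} e he => ?_, fun K _ _ hK D c hc => ?_⟩
  · refine Sheaf.mem_finestTopology_of_forall_isSheafFor ?_
    rintro _ ⟨Z, rfl⟩ Y f
    have h := IsPullback.of_hasPullback f e
    have hs := pullback_generate_ofArrows (ι := PUnit.{1}) fun _ => h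
    rw [Presieve.ofArrows_pUnit, Presieve.ofArrows_pUnit] at hs
    rw [hs]
    exact (hreg _ _ _ _ h he).isSheafFor_generate Z
  · refine Sheaf.mem_finestTopology_of_forall_isSheafFor ?_
    rintro _ ⟨Z, rfl⟩ Y f
    have := hfilt K hK
    have := (hcomm K hK).some
    have := IsFiltered.isConnected K
    have h := IsPullback.of_hasPullback ((Functor.const K).map f) c.ι
    obtain ⟨hc'⟩ := nonempty_isColimit_of_isPullback hc.some h
    have hk (k : K) : IsPullback ((pullback.fst ((Functor.const K).map f) c.ι).app k)
        ((pullback.snd ((Functor.const K).map f) c.ι).app k) f (c.ι.app k) :=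
      h.map ((evaluation K C).obj k)
    rw [pullback_generate_ofArrows hk]
    exact isSheafFor_generate_of_isColimit hc' Z

/-- Under (E1') and (E2'), the topology generated by regular epimorphisms and filtered
κ'-colimit cocones is subcanonical: every representable presheaf is a sheaf. -/
theorem statement5 (κ : Cardinal.{u}) (hκ : κ.IsRegular) (C : Type u) [SmallCategory C]
    (hlim : ∀ (I : Type u) [SmallCategory I], homCard I < κ → HasLimitsOfShape I C)
    [HasReflexiveCoequalizers C]
    (hfilt : ∀ (K : Type u) [SmallCategory K] [IsFiltered K],
      homCard K < kappaPrime κ → HasColimitsOfShape K C)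
    (hE1 : BarrExact C) (hE2 : FinLimsCommuteFilteredColimsBdd C (kappaPrime κ)) :
    ∀ X : C, Presieve.IsSheaf (genTopology C κ) (yoneda.obj X) := by
  have := hasPullbacks_of_hasLimitsOfShape hκ.aleph0_le hlim
  exact fun X => Presieve.isSheaf_of_le _
    (genTopology_le_canonicalTopology κ hfilt hE1.1 hE2) (Sheaf.isSheaf_yoneda_obj X)

end AlgExact
end

section
/- Let C be a small category, J a Grothendieck topology on C, and κ a regular cardinal. The sheafification functor L : [C^op, Set] → Sh(C, J) (the left exact left adjoint to the inclusion of sheaves into presheaves) preserves all limits of diagrams whose indexing category has fewer than κ morphisms if and only if for every object X of C, the intersection of any family of fewer than κ J-covering sieves on X is again a J-covering sieve. -/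
open CategoryTheory CategoryTheory.Limits Opposite

universe w v u

namespace AlgExact

/-- The discrete category on `ι` has as many morphisms as `ι` has elements. -/
lemma homCard_discrete (ι : Type u) : homCard (Discrete ι) = Cardinal.mk ι :=
  Cardinal.mk_congr
    { toFun := fun f => f.1.as
      invFun := fun i => ⟨⟨i⟩, ⟨i⟩, 𝟙 _⟩
      left_inv := by
        rintro ⟨⟨i⟩, ⟨j⟩, ⟨⟨h⟩⟩⟩
        obtain rfl : i = j := h
        rfl
      right_inv := fun _ => rfl }

lemma mk_le_homCard (I : Type u) [SmallCategory I] : Cardinal.mk I ≤ homCard I :=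
  Cardinal.mk_le_of_injective (f := fun i => (⟨i, i, 𝟙 i⟩ : Σ (X : I) (Y : I), X ⟶ Y))
    fun _ _ h => congrArg Sigma.fst h

lemma sieve_iInf_apply {C : Type u} [SmallCategory C] {X Y : C} {ι : Type*} (S : ι → Sieve X)
    (f : Y ⟶ X) : (⨅ i, S i) f ↔ ∀ i, S i f := by
  rw [iInf, Sieve.sInf_apply]
  exact ⟨fun h i => h _ ⟨i, rfl⟩, by rintro h _ ⟨i, rfl⟩; exact h i⟩

section LimitComparison

variable {C : Type u} [SmallCategory C] {J : GrothendieckTopology C}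
  {I : Type u} [SmallCategory I] {F G : I ⥤ Cᵒᵖ ⥤ Type u} {α : F ⟶ G}
  {c : Cone F} {d : Cone G} {φ : c.pt ⟶ d.pt}

lemma cone_π_naturality (c : Cone F) (i : I) {X Y : Cᵒᵖ} (f : X ⟶ Y) (x : c.pt.obj X) :
    (c.π.app i).app Y (c.pt.map f x) = (F.obj i).map f ((c.π.app i).app X x) :=
  ConcreteCategory.congr_hom ((c.π.app i).naturality f) x

/-- Sections of a limit of presheaves of types are determined by their projections. -/
lemma presheaf_limit_ext (hc : IsLimit c) {X : Cᵒᵖ} {x y : c.pt.obj X}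
    (h : ∀ i, (c.π.app i).app X x = (c.π.app i).app X y) : x = y :=
  (Types.isLimitEquivSections (isLimitOfPreserves ((evaluation Cᵒᵖ (Type u)).obj X) hc)).injective
    (Subtype.ext (funext h))

/-- Compatible families of sections come from a section of the limit. -/
lemma exists_presheaf_limit_section (hc : IsLimit c) {X : Cᵒᵖ} (a : ∀ i, (F.obj i).obj X)
    (ha : ∀ {i j : I} (u : i ⟶ j), (F.map u).app X (a i) = a j) :
    ∃ x : c.pt.obj X, ∀ i, (c.π.app i).app X x = a i :=
  let hcX := isLimitOfPreserves ((evaluation Cᵒᵖ (Type u)).obj X) hc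
  ⟨(Types.isLimitEquivSections hcX).symm ⟨a, fun u => ha u⟩,
    fun i => Types.isLimitEquivSections_symm_apply hcX ⟨a, fun u => ha u⟩ i⟩

lemma isLocallyInjective_of_isLimit
    (hobj : ∀ (X : C) (S : I → Sieve X), (∀ i, S i ∈ J X) → (⨅ i, S i) ∈ J X)
    (hα : ∀ i, Presheaf.IsLocallyInjective J (α.app i))
    (hc : IsLimit c) (hφ : ∀ i, φ ≫ d.π.app i = c.π.app i ≫ α.app i) :
    Presheaf.IsLocallyInjective J φ where
  equalizerSieve_mem {X} x y hxy := by
    refine J.superset_covering ?_ (hobj X.unop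
      (fun i => Presheaf.equalizerSieve ((c.π.app i).app X x) ((c.π.app i).app X y))
      fun i => Presheaf.equalizerSieve_mem J (α.app i) _ _ ?_)
    · intro Y f hf
      refine presheaf_limit_ext hc fun i => ?_
      have hi : (F.obj i).map f.op ((c.π.app i).app X x) =
          (F.obj i).map f.op ((c.π.app i).app X y) :=
        (sieve_iInf_apply _ f).1 hf i
      exact (cone_π_naturality c i f.op x).trans (hi.trans (cone_π_naturality c i f.op y).symm)
    · have key (z : c.pt.obj X) :
          (α.app i).app X ((c.π.app i).app X z) = (d.π.app i).app X (φ.app X z) :=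
        (ConcreteCategory.congr_hom (NatTrans.congr_app (hφ i) X) z).symm
      rw [key, key, hxy]

lemma isLocallySurjective_of_isLimit
    (hobj : ∀ (X : C) (S : I → Sieve X), (∀ i, S i ∈ J X) → (⨅ i, S i) ∈ J X)
    (hhom : ∀ (X : C) (S : (Σ (i : I) (j : I), i ⟶ j) → Sieve X),
      (∀ u, S u ∈ J X) → (⨅ u, S u) ∈ J X)
    (hα : ∀ i, Presheaf.IsLocallyInjective J (α.app i))
    (hα' : ∀ i, Presheaf.IsLocallySurjective J (α.app i))
    (hc : IsLimit c) (hd : IsLimit d) (hφ : ∀ i, φ ≫ d.π.app i = c.π.app i ≫ α.app i) :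
    Presheaf.IsLocallySurjective J φ where
  imageSieve_mem {X} z := by
    refine J.transitive (hobj X
      (fun i => Presheaf.imageSieve (α.app i) ((d.π.app i).app (op X) z))
      fun i => Presheaf.imageSieve_mem J (α.app i) _) _ fun Y f hf => ?_
    have hf' (i : I) : ∃ t : (F.obj i).obj (op Y),
        (α.app i).app (op Y) t = (G.obj i).map f.op ((d.π.app i).app (op X) z) :=
      (sieve_iInf_apply _ f).1 hf i
    choose a ha using hf'
    refine J.superset_covering ?_ (hhom Y
      (fun u => Presheaf.equalizerSieve ((F.map u.2.2).app (op Y) (a u.1)) (a u.2.1))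
      fun u => Presheaf.equalizerSieve_mem J (α.app u.2.1) _ _ ?_)
    · intro Z g hg
      have hg' {i j : I} (u : i ⟶ j) : (F.obj j).map g.op ((F.map u).app (op Y) (a i)) =
          (F.obj j).map g.op (a j) :=
        (sieve_iInf_apply _ g).1 hg ⟨i, j, u⟩
      obtain ⟨x, hx⟩ := exists_presheaf_limit_section hc (X := op Z)
        (fun i => (F.obj i).map g.op (a i)) fun {i j} u => by
          rw [← hg' u, NatTrans.naturality_apply]
      refine ⟨x, presheaf_limit_ext hd fun i => ?_⟩
      have key : (d.π.app i).app (op Z) (φ.app (op Z) x) =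
          (α.app i).app (op Z) ((c.π.app i).app (op Z) x) :=
        ConcreteCategory.congr_hom (NatTrans.congr_app (hφ i) (op Z)) x
      rw [key, hx, NatTrans.naturality_apply, ha, cone_π_naturality, op_comp,
        Functor.map_comp_apply]
    · obtain ⟨i, j, u⟩ := u
      have h₁ : (α.app j).app (op Y) ((F.map u).app (op Y) (a i)) =
          (G.map u).app (op Y) ((α.app i).app (op Y) (a i)) :=
        ConcreteCategory.congr_hom (NatTrans.congr_app (α.naturality u) (op Y)) (a i)
      have h₂ : (G.map u).app (op X) ((d.π.app i).app (op X) z) = (d.π.app j).app (op X) z :=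
        ConcreteCategory.congr_hom (NatTrans.congr_app (d.w u) (op X)) z
      rw [h₁, ha, ha, NatTrans.naturality_apply, h₂]

end LimitComparison

section

variable {C : Type u} [SmallCategory C] {J : GrothendieckTopology C}

lemma preservesLimitsOfShape_presheafToSheaf {I : Type u} [SmallCategory I]
    (hobj : ∀ (X : C) (S : I → Sieve X), (∀ i, S i ∈ J X) → (⨅ i, S i) ∈ J X)
    (hhom : ∀ (X : C) (S : (Σ (i : I) (j : I), i ⟶ j) → Sieve X),
      (∀ u, S u ∈ J X) → (⨅ u, S u) ∈ J X) :
    PreservesLimitsOfShape I (presheafToSheaf J (Type u)) where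
  preservesLimit {F} := by
    let L := presheafToSheaf J (Type u)
    let α : F ⟶ (F ⋙ L) ⋙ sheafToPresheaf J (Type u) :=
      Functor.whiskerLeft F (sheafificationAdjunction J (Type u)).unit
    let φ : limit F ⟶ ((sheafToPresheaf J (Type u)).mapCone (limit.cone (F ⋙ L))).pt :=
      toSheafify J (limit F) ≫ (sheafToPresheaf J (Type u)).map (limit.post F L)
    have hφ (i : I) : φ ≫ ((sheafToPresheaf J (Type u)).mapCone (limit.cone (F ⋙ L))).π.app i =
        limit.π F i ≫ α.app i := by
      have h : limit.post F L ≫ limit.π (F ⋙ L) i = L.map (limit.π F i) := limit.post_π F L i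
      have h' := (sheafificationAdjunction J (Type u)).unit.naturality (limit.π F i)
      dsimp [φ, α] at h' ⊢
      rw [Category.assoc, ← ObjectProperty.FullSubcategory.comp_hom, h]
      exact h'.symm
    have hα (i : I) : J.W (α.app i) := J.W_toSheafify (F.obj i)
    have hd := isLimitOfPreserves (sheafToPresheaf J (Type u)) (limit.isLimit (F ⋙ L))
    have hW : J.W φ := (J.W_iff_isLocallyBijective φ).2
      ⟨isLocallyInjective_of_isLimit hobj (fun i => (hα i).isLocallyInjective)
          (limit.isLimit F) hφ,
        isLocallySurjective_of_isLimit hobj hhom (fun i => (hα i).isLocallyInjective)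
          (fun i => (hα i).isLocallySurjective) (limit.isLimit F) hd hφ⟩
    have : IsIso (limit.post F L) := by
      rw [← J.W_sheafToPresheaf_map_iff_isIso]
      exact J.W.of_precomp _ _ (J.W_toSheafify (limit F)) hW
    exact preservesLimit_of_isIso_post L F

lemma W_functorInclusion {X : C} {S : Sieve X} (hS : S ∈ J X) : J.W S.functorInclusion := by
  refine (J.W_iff_isLocallyBijective _).2
    ⟨Presheaf.isLocallyInjective_of_injective J _ fun _ _ _ h => Subtype.ext h, ⟨?_⟩⟩
  intro U (s : U ⟶ X)
  exact J.superset_covering (fun V g hg => ⟨⟨g ≫ s, hg⟩, rfl⟩) (J.pullback_stable s hS)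

lemma W_limMap {I : Type u} [SmallCategory I]
    [PreservesLimitsOfShape I (presheafToSheaf J (Type u))] {F G : I ⥤ Cᵒᵖ ⥤ Type u}
    (α : F ⟶ G) (hα : ∀ i, J.W (α.app i)) : J.W (lim.map α) := by
  rw [J.W_iff]
  have (i : I) : IsIso ((Functor.whiskerRight α (presheafToSheaf J (Type u))).app i) :=
    (J.W_iff _).1 (hα i)
  have : IsIso (Functor.whiskerRight α (presheafToSheaf J (Type u))) :=
    NatIso.isIso_of_isIso_app _
  refine (NatIso.isIso_map_iff (preservesLimitNatIso (presheafToSheaf J (Type u))) α).2 ?_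
  exact inferInstanceAs (IsIso (lim.map (Functor.whiskerRight α (presheafToSheaf J (Type u)))))

lemma iInf_mem_of_preservesProducts {X : C} {ι : Type u}
    [PreservesLimitsOfShape (Discrete ι) (presheafToSheaf J (Type u))]
    (S : ι → Sieve X) (hS : ∀ i, S i ∈ J X) : (⨅ i, S i) ∈ J X := by
  let F : Discrete ι ⥤ Cᵒᵖ ⥤ Type u := Discrete.functor fun i => (S i).functor
  let G : Discrete ι ⥤ Cᵒᵖ ⥤ Type u := Discrete.functor fun _ => yoneda.obj X
  let α : F ⟶ G := Discrete.natTrans fun i => (S i.as).functorInclusion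
  have := (W_limMap (J := J) α fun i => W_functorInclusion (hS i.as)).isLocallySurjective
  obtain ⟨x, hx⟩ := exists_presheaf_limit_section (limit.isLimit G) (X := op X)
    (fun _ => 𝟙 X) (by
      rintro ⟨i⟩ ⟨j⟩ ⟨⟨h⟩⟩
      obtain rfl : i = j := h
      exact ConcreteCategory.congr_hom (NatTrans.congr_app (G.map_id ⟨i⟩) (op X)) (𝟙 X))
  refine J.superset_covering ?_ (Presheaf.imageSieve_mem J (lim.map α) x)
  rintro Y f ⟨t, ht⟩
  refine (sieve_iInf_apply S f).2 fun i => ?_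
  let s : { g : Y ⟶ X // S i g } := (limit.π F ⟨i⟩).app (op Y) t
  have h₁ : s.1 = (limit.π G ⟨i⟩).app (op Y) ((lim.map α).app (op Y) t) :=
    (ConcreteCategory.congr_hom (NatTrans.congr_app (limMap_π α ⟨i⟩) (op Y)) t).symm
  have h₂ : (limit.π G ⟨i⟩).app (op Y) ((limit G).map f.op x) = f := by
    rw [NatTrans.naturality_apply]
    refine (congrArg ((G.obj ⟨i⟩).map f.op) (hx ⟨i⟩)).trans ?_
    exact Category.comp_id f
  have h₃ : s.1 = f := by
    rw [h₁, ht]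
    exact h₂
  exact h₃ ▸ s.2

end

/-- Sheafification preserves κ-small limits iff covering sieves are closed under
κ-small intersections. -/
theorem statement8 (κ : Cardinal.{u}) (hκ : κ.IsRegular) (C : Type u) [SmallCategory C]
    (J : GrothendieckTopology C) :
    (∀ (I : Type u) [SmallCategory I], homCard I < κ →
        Nonempty (PreservesLimitsOfShape I (presheafToSheaf J (Type u)))) ↔
    (∀ (X : C) (ι : Type u) (S : ι → Sieve X), Cardinal.mk ι < κ →
        (∀ i, S i ∈ J X) → (⨅ i, S i) ∈ J X) := by
  refine ⟨fun h X ι S hι hS => ?_, fun h I _ hI => ⟨?_⟩⟩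
  · have := (h (Discrete ι) ((homCard_discrete ι).trans_lt hι)).some
    exact iInf_mem_of_preservesProducts S hS
  · exact preservesLimitsOfShape_presheafToSheaf
      (fun X S => h X I S ((mk_le_homCard I).trans_lt hI)) fun X S => h X _ S hI

end AlgExact
end

section
/- Let C be a category with pullbacks and products of fewer than κ objects, in which regular epimorphisms are stable under pullback and under products of fewer than κ objects. Let (e_i : A_i → X)_{i ∈ I} be a family of regular epimorphisms with |I| < κ, and let e : A → X be the pullback of Π_i e_i : Π_i A_i → Π_i X along the diagonal X → Π_i X. Then e is a regular epimorphism, and the sieve on X generated by e equals the intersection of the sieves generated by the individual e_i (equivalently: a morphism Z → X factors through e if and only if it factors through every e_i). -/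
open CategoryTheory CategoryTheory.Limits Opposite

universe w v u

namespace AlgExact

/-- (E3'): regular epimorphisms are stable by κ-small products. -/
def RegEpisStableByProductsBdd (C : Type u) [Category.{v} C] (κ : Cardinal.{v}) : Prop :=
  ∀ (I : Type v), Cardinal.mk I < κ →
    ∀ (X Y : I → C) (f : ∀ i, X i ⟶ Y i) [HasProduct X] [HasProduct Y],
      (∀ i, IsRegularEpi (f i)) → IsRegularEpi (Limits.Pi.map f)

/-- A morphism factors through the pullback of `Π e i` along the diagonal if and only if it
factors through every `e i`. -/
theorem factors_pullback_diagonal_iff {C : Type u} [Category.{v} C] [HasPullbacks C] {I : Type w}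
    {A : I → C} {X : C} (e : ∀ i, A i ⟶ X) [HasProduct A] [HasProduct (fun _ : I => X)]
    {Z : C} (h : Z ⟶ X) :
    (∃ t, t ≫ pullback.snd (Limits.Pi.map e) (Limits.Pi.lift fun _ : I => 𝟙 X) = h) ↔
      ∀ i, ∃ t, t ≫ e i = h := by
  constructor
  · rintro ⟨t, rfl⟩ i
    refine ⟨t ≫ pullback.fst _ _ ≫ Limits.Pi.π A i, ?_⟩
    have w := pullback.condition (f := Limits.Pi.map e)
      (g := Limits.Pi.lift fun _ : I => 𝟙 X) =≫ Limits.Pi.π _ i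
    simp only [Category.assoc, Limits.Pi.map_π, Limits.Pi.lift_π, Category.comp_id] at w
    simp only [Category.assoc, w]
  · intro H
    choose t ht using H
    refine ⟨pullback.lift (Limits.Pi.lift t) h ?_, pullback.lift_snd _ _ _⟩
    ext i
    simp [ht]

/-- Pulling back a κ-small product of regular epis along the diagonal yields a regular
epi generating the intersection of the sieves generated by the factors. -/
theorem statement10 (κ : Cardinal.{v}) (hκ : κ.IsRegular) (C : Type u) [Category.{v} C]
    [HasPullbacks C]
    (hprod : ∀ (ι : Type v), Cardinal.mk ι < κ → HasLimitsOfShape (Discrete ι) C)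
    (hpb : RegEpisStableUnderPullback C)
    (hstab : RegEpisStableByProductsBdd C κ)
    (I : Type v) (hI : Cardinal.mk I < κ) (A : I → C) (X : C) (e : ∀ i, A i ⟶ X)
    (he : ∀ i, IsRegularEpi (e i)) [HasProduct A] [HasProduct (fun _ : I => X)] :
    IsRegularEpi (pullback.snd (Limits.Pi.map e) (Limits.Pi.lift fun _ : I => 𝟙 X)) ∧
    Sieve.generate (Presieve.singleton
        (pullback.snd (Limits.Pi.map e) (Limits.Pi.lift fun _ : I => 𝟙 X))) =
      (⨅ i, Sieve.generate (Presieve.singleton (e i))) ∧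
    (∀ (Z : C) (h : Z ⟶ X),
      (∃ t, t ≫ pullback.snd (Limits.Pi.map e) (Limits.Pi.lift fun _ : I => 𝟙 X) = h) ↔
        ∀ i, ∃ t, t ≫ e i = h) := by
  refine ⟨?_, ?_, fun Z h => factors_pullback_diagonal_iff e h⟩
  · exact hpb _ _ _ _ (IsPullback.of_hasPullback _ _).flip (hstab I hI _ _ e he)
  · ext Z h
    simp only [Sieve.generate_apply, iInf, Sieve.sInf_apply, Set.forall_mem_range]
    have key {W : C} (f : W ⟶ X) :
        (∃ (Y : C) (t : Z ⟶ Y) (g : Y ⟶ X), Presieve.singleton f g ∧ t ≫ g = h) ↔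
          ∃ t, t ≫ f = h := by
      constructor
      · rintro ⟨_, t, _, ⟨⟩, ht⟩
        exact ⟨t, ht⟩
      · rintro ⟨t, ht⟩
        exact ⟨_, t, f, ⟨⟩, ht⟩
    simpa only [key] using factors_pullback_diagonal_iff e h

end AlgExact
end
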